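/- Let A be a unital complex Banach algebra and a, b ∈ A with σ(a) finite. Then d(a,b) = 0 if and only if σ(a) = σ(b) and p(λ,a) = p(λ,b) for every λ ∈ σ(a). -/

import Mathlib

open Filter Metric

variable {A : Type*}

/-- The operator `C_{a,b} = L_a - R_b`. -/
noncomputable def Cop [NormedRing A] [NormedAlgebra ℂ A] (a b : A) : Module.End ℂ A :=
  LinearMap.mulLeft ℂ a - LinearMap.mulRight ℂ b

/-- `ρ(a,b) = limsup_n ‖C_{a,b}^n 1‖^{1/n}`. -/
noncomputable def rho [NormedRing A] [NormedAlgebra ℂ A] (a b : A) : ℝ :=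
  Filter.limsup (fun n : ℕ => ‖(Cop a b ^ n) 1‖ ^ (1 / (n : ℝ))) Filter.atTop

/-- The spectral semidistance `d(a,b) = max{ρ(a,b), ρ(b,a)}`. -/
noncomputable def qd [NormedRing A] [NormedAlgebra ℂ A] (a b : A) : ℝ :=
  max (rho a b) (rho b a)

/-- The Riesz projection of `a` at `lam`, computed over a circle of radius `r`. -/
noncomputable def rieszP [NormedRing A] [NormedAlgebra ℂ A] (a : A) (lam : ℂ) (r : ℝ) : A :=
  ((2 * Real.pi * Complex.I : ℂ))⁻¹ •
    circleIntegral (fun z => Ring.inverse (algebraMap ℂ A z - a)) lam r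

open scoped Classical in
/-- The Riesz projection at an isolated spectral point (radius chosen by choice). -/
noncomputable def rieszIdem [NormedRing A] [NormedAlgebra ℂ A] (a : A) (lam : ℂ) : A :=
  if h : ∃ r : ℝ, 0 < r ∧ spectrum ℂ a ∩ closedBall lam r = {lam}
  then rieszP a lam h.choose else 0

/-- The Aupetit–Mouton spectral rank. -/
noncomputable def sRank [NormedRing A] [NormedAlgebra ℂ A] (a : A) : ℕ∞ :=
  ⨆ x : A, (spectrum ℂ (x * a) \ {0}).encard

/-- Spectral multiplicity at a nonzero isolated spectral point: rank of the Riesz projection. -/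
noncomputable def sMult [NormedRing A] [NormedAlgebra ℂ A] (a : A) (lam : ℂ) : ℕ :=
  (sRank (rieszIdem a lam)).toNat

/-- The Aupetit–Mouton spectral trace. -/
noncomputable def sTrace [NormedRing A] [NormedAlgebra ℂ A] (a : A) : ℂ :=
  ∑ᶠ lam ∈ spectrum ℂ a \ {0}, lam * (sMult a lam : ℂ)

/-- `det(1 + λ a)`, the Aupetit–Mouton spectral determinant. -/
noncomputable def sDet [NormedRing A] [NormedAlgebra ℂ A] (a : A) (lam : ℂ) : ℂ :=
  ∏ᶠ mu ∈ spectrum ℂ a \ {0}, (1 + lam * mu) ^ sMult a mu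

/-- The socle: the sum of all minimal left ideals. -/
def socle (A : Type*) [Ring A] : Ideal A := sSup {I : Ideal A | IsAtom I}

/-- Semisimplicity: the Jacobson radical is zero. -/
def IsSemisimpleBA (A : Type*) [Ring A] : Prop := Ideal.jacobson (⊥ : Ideal A) = ⊥

/-- A sequence of reals that is dominated by every geometric sequence `ε ^ n` with `ε > 0`. -/
def SubgeometricDecay (u : ℕ → ℝ) : Prop :=
  ∀ ε > 0, ∃ K, ∀ n, u n ≤ K * ε ^ n

theorem exists_le_mul_pow_of_eventually_le {u : ℕ → ℝ} {ε : ℝ} (hε : 0 < ε)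
    (h : ∀ᶠ n in atTop, u n ≤ ε ^ n) : ∃ K, ∀ n, u n ≤ K * ε ^ n := by
  have hb : IsBoundedUnder (· ≤ ·) atTop (fun n => u n / ε ^ n) := by
    refine isBoundedUnder_of_eventually_le (a := 1) ?_
    filter_upwards [h] with n hn
    exact (div_le_one (pow_pos hε n)).2 hn
  obtain ⟨K, hK⟩ := hb.bddAbove_range
  exact ⟨K, fun n => (div_le_iff₀ (pow_pos hε n)).1 (hK ⟨n, rfl⟩)⟩

theorem exists_le_mul_pow_of_eventually_rpow_lt {u : ℕ → ℝ} (hu : ∀ n, 0 ≤ u n) {ε : ℝ}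
    (hε : 0 < ε) (h : ∀ᶠ n : ℕ in atTop, u n ^ (1 / (n : ℝ)) < ε) :
    ∃ K, ∀ n, u n ≤ K * ε ^ n := by
  refine exists_le_mul_pow_of_eventually_le hε ?_
  filter_upwards [h, eventually_ge_atTop 1] with n hn hn1
  have hn0 : n ≠ 0 := by lia
  have := pow_le_pow_left₀ (Real.rpow_nonneg (hu n) _) hn.le n
  rwa [one_div, Real.rpow_inv_natCast_pow (hu n) hn0] at this

theorem rpow_le_of_le_pow {x y : ℝ} (hx : 0 ≤ x) (hy : 0 ≤ y) {n : ℕ} (hn : n ≠ 0)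
    (h : x ≤ y ^ n) : x ^ (1 / (n : ℝ)) ≤ y := by
  rw [one_div]
  exact (Real.rpow_le_rpow hx h (by positivity)).trans_eq (Real.pow_rpow_inv_natCast hy hn)

theorem isBoundedUnder_rpow_of_le_mul_pow {u : ℕ → ℝ} (hu : ∀ n, 0 ≤ u n) {K M : ℝ}
    (hM : 0 ≤ M) (h : ∀ n, u n ≤ K * M ^ n) :
    IsBoundedUnder (· ≤ ·) atTop (fun n : ℕ => u n ^ (1 / (n : ℝ))) := by
  refine isBoundedUnder_of_eventually_le (a := max K 1 * M) ?_
  filter_upwards [eventually_ge_atTop 1] with n hn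
  have hn0 : n ≠ 0 := by lia
  refine rpow_le_of_le_pow (hu n) (by positivity) hn0 ((h n).trans ?_)
  rw [mul_pow]
  gcongr
  exact (le_max_left K 1).trans (le_self_pow₀ (le_max_right K 1) hn0)

theorem limsup_rpow_nonneg {u : ℕ → ℝ} (hu : ∀ n, 0 ≤ u n)
    (hb : IsBoundedUnder (· ≤ ·) atTop (fun n : ℕ => u n ^ (1 / (n : ℝ)))) :
    0 ≤ limsup (fun n : ℕ => u n ^ (1 / (n : ℝ))) atTop :=
  le_limsup_of_frequently_le (Frequently.of_forall fun n => Real.rpow_nonneg (hu n) _) hb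

theorem limsup_rpow_eq_zero_iff {u : ℕ → ℝ} (hu : ∀ n, 0 ≤ u n)
    (hb : IsBoundedUnder (· ≤ ·) atTop (fun n : ℕ => u n ^ (1 / (n : ℝ)))) :
    limsup (fun n : ℕ => u n ^ (1 / (n : ℝ))) atTop = 0 ↔ SubgeometricDecay u := by
  refine ⟨fun h ε hε => exists_le_mul_pow_of_eventually_rpow_lt hu hε
    (eventually_lt_of_limsup_lt (h.trans_lt hε) hb), fun h => ?_⟩
  refine le_antisymm (le_of_forall_pos_le_add fun ε hε => ?_) (limsup_rpow_nonneg hu hb)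
  rw [zero_add]
  obtain ⟨K, hK⟩ := h (ε / 2) (by positivity)
  refine limsup_le_of_le (isCoboundedUnder_le_of_le atTop (x := 0)
    fun n => Real.rpow_nonneg (hu n) _) ?_
  filter_upwards [eventually_ge_atTop 1,
    (tendsto_pow_atTop_atTop_of_one_lt (one_lt_two (α := ℝ))).eventually_ge_atTop K]
    with n hn hKn
  refine rpow_le_of_le_pow (hu n) hε.le (by lia) ((hK n).trans ?_)
  calc K * (ε / 2) ^ n ≤ 2 ^ n * (ε / 2) ^ n := by gcongr
    _ = ε ^ n := by rw [← mul_pow]; congr 1; ring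

theorem SubgeometricDecay.summable_mul_pow {u : ℕ → ℝ} (hd : SubgeometricDecay u)
    (hu : ∀ n, 0 ≤ u n) {M : ℝ} (hM : 0 ≤ M) : Summable (fun n => M ^ n * u n) := by
  obtain ⟨K, hK⟩ := hd (2 * (M + 1))⁻¹ (by positivity)
  have hq : M * (2 * (M + 1))⁻¹ < 1 := by
    rw [← div_eq_mul_inv, div_lt_one (by positivity)]; linarith
  refine Summable.of_nonneg_of_le (fun n => mul_nonneg (by positivity) (hu n)) (fun n => ?_)
    ((summable_geometric_of_lt_one (by positivity) hq).mul_left K)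
  calc M ^ n * u n ≤ M ^ n * (K * (2 * (M + 1))⁻¹ ^ n) := by gcongr; exact hK n
    _ = K * (M * (2 * (M + 1))⁻¹) ^ n := by rw [mul_pow]; ring

theorem norm_pow_le_norm_one_mul [NormedRing A] (a : A) (n : ℕ) : ‖a ^ n‖ ≤ max ‖(1 : A)‖ 1 * ‖a‖ ^ n := by
  rcases n.eq_zero_or_pos with rfl | hn
  · simp
  · exact (norm_pow_le' a hn).trans
      (le_mul_of_one_le_left (by positivity) (le_max_right _ _))

theorem Summable.hasSum_sub_succ [NormedRing A] {g : ℕ → A} (hg : Summable g) :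
    HasSum (fun n => g n - g (n + 1)) (g 0) := by
  have := hg.hasSum.sub ((hasSum_nat_add_iff' 1).2 hg.hasSum)
  simpa using this

theorem summable_mul_pow_of_subgeometricDecay [NormedRing A] [CompleteSpace A] {c : ℕ → A}
    (hc : SubgeometricDecay (fun n => ‖c n‖)) (R : A) :
    Summable (fun n => c n * R ^ n) := by
  refine .of_norm_bounded ((hc.summable_mul_pow (fun _ => norm_nonneg _)
    (norm_nonneg R)).mul_left (max ‖(1 : A)‖ 1)) fun n => ?_
  rw [← mul_assoc, mul_comm]
  exact (norm_mul_le _ _).trans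
    (mul_le_mul_of_nonneg_left (norm_pow_le_norm_one_mul R n) (norm_nonneg _))

section NormedAlgebra

variable [NormedRing A] [NormedAlgebra ℂ A]

theorem Cop_apply (a b x : A) : Cop a b x = a * x - x * b := by
  simp [Cop]

theorem Cop_pow_succ_one (a b : A) (n : ℕ) :
    (Cop a b ^ (n + 1)) 1 = a * (Cop a b ^ n) 1 - (Cop a b ^ n) 1 * b := by
  rw [pow_succ', Module.End.mul_apply, Cop_apply]

theorem norm_Cop_pow_one_le {a b : A} {K L α β : ℝ} (ha : ∀ n, ‖a ^ n‖ ≤ K * α ^ n)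
    (hb : ∀ n, ‖b ^ n‖ ≤ L * β ^ n) (n : ℕ) :
    ‖(Cop a b ^ n) 1‖ ≤ K * L * (α + β) ^ n := by
  have hneg : ∀ k, ‖(-b) ^ k‖ ≤ L * β ^ k := fun k => by
    rcases Nat.even_or_odd k with hk | hk
    · rw [hk.neg_pow]; exact hb k
    · rw [hk.neg_pow, norm_neg]; exact hb k
  have hC : Cop a b = LinearMap.mulLeft ℂ a + LinearMap.mulRight ℂ (-b) := by
    ext x; simp [Cop_apply, sub_eq_add_neg]
  rw [hC, (LinearMap.commute_mulLeft_right a (-b)).add_pow, LinearMap.sum_apply, add_pow,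
    Finset.mul_sum]
  refine (norm_sum_le _ _).trans (Finset.sum_le_sum fun m _ => ?_)
  have happ : (LinearMap.mulLeft ℂ a ^ m * LinearMap.mulRight ℂ (-b) ^ (n - m) *
      ((n.choose m : ℕ) : Module.End ℂ A)) 1 = n.choose m • (a ^ m * (-b) ^ (n - m)) := by
    rw [LinearMap.pow_mulLeft, LinearMap.pow_mulRight]
    simp [Module.End.mul_apply, ← nsmul_eq_mul]
  rw [happ]
  refine norm_nsmul_le.trans ?_
  have h1 : ‖a ^ m * (-b) ^ (n - m)‖ ≤ (K * α ^ m) * (L * β ^ (n - m)) :=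
    (norm_mul_le _ _).trans (mul_le_mul (ha m) (hneg _) (norm_nonneg _)
      ((norm_nonneg _).trans (ha m)))
  calc (n.choose m : ℝ) * ‖a ^ m * (-b) ^ (n - m)‖
      ≤ n.choose m * ((K * α ^ m) * (L * β ^ (n - m))) := by gcongr
    _ = K * L * (α ^ m * β ^ (n - m) * n.choose m) := by ring

theorem isBoundedUnder_norm_Cop_pow_one (a b : A) :
    IsBoundedUnder (· ≤ ·) atTop (fun n : ℕ => ‖(Cop a b ^ n) 1‖ ^ (1 / (n : ℝ))) :=
  isBoundedUnder_rpow_of_le_mul_pow (fun _ => norm_nonneg _) (by positivity)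
    (norm_Cop_pow_one_le (norm_pow_le_norm_one_mul a) (norm_pow_le_norm_one_mul b))

theorem rho_nonneg (a b : A) : 0 ≤ rho a b :=
  limsup_rpow_nonneg (fun _ => norm_nonneg _) (isBoundedUnder_norm_Cop_pow_one a b)

theorem rho_eq_zero_iff (a b : A) :
    rho a b = 0 ↔ SubgeometricDecay (fun n => ‖(Cop a b ^ n) 1‖) :=
  limsup_rpow_eq_zero_iff (fun _ => norm_nonneg _) (isBoundedUnder_norm_Cop_pow_one a b)

theorem qd_eq_zero_iff (a b : A) : qd a b = 0 ↔ rho a b = 0 ∧ rho b a = 0 := by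
  refine ⟨fun h => ⟨?_, ?_⟩, fun h => by simp [qd, h.1, h.2]⟩
  · exact le_antisymm ((le_max_left _ _).trans_eq h) (rho_nonneg a b)
  · exact le_antisymm ((le_max_right _ _).trans_eq h) (rho_nonneg b a)

theorem Cop_pow_one_add_left_right {h s t : A} (hs : Commute h s) (ht : Commute h t) (n : ℕ) :
    (Cop (h + s) (h + t) ^ n) 1 = (Cop s t ^ n) 1 := by
  suffices (Cop (h + s) (h + t) ^ n) 1 = (Cop s t ^ n) 1 ∧ Commute h ((Cop s t ^ n) 1) from this.1
  induction n with
  | zero => simp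
  | succ n ih =>
    rw [pow_succ', pow_succ', Module.End.mul_apply, Module.End.mul_apply, ih.1, Cop_apply,
      Cop_apply]
    refine ⟨?_, (hs.mul_right ih.2).sub_right (ih.2.mul_right ht)⟩
    rw [add_mul, mul_add, ih.2.eq]
    abel

theorem rho_eq_zero_of_commute {h a b : A} (ha : Commute h a) (hb : Commute h b)
    (hda : SubgeometricDecay (fun n => ‖(a - h) ^ n‖))
    (hdb : SubgeometricDecay (fun n => ‖(b - h) ^ n‖)) : rho a b = 0 := by
  rw [rho_eq_zero_iff]
  intro ε hε
  obtain ⟨K, hK⟩ := hda (ε / 2) (by positivity)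
  obtain ⟨L, hL⟩ := hdb (ε / 2) (by positivity)
  refine ⟨K * L, fun n => ?_⟩
  have := norm_Cop_pow_one_le hK hL n
  rwa [add_halves, ← Cop_pow_one_add_left_right (ha.sub_right (.refl h))
    (hb.sub_right (.refl h)), add_sub_cancel, add_sub_cancel] at this

theorem resolvent_mul_sub {a : A} {z : ℂ} (hz : z ∈ resolventSet ℂ a) :
    resolvent a z * (algebraMap ℂ A z - a) = 1 :=
  Ring.inverse_mul_cancel _ hz

theorem sub_mul_resolvent {a : A} {z : ℂ} (hz : z ∈ resolventSet ℂ a) :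
    (algebraMap ℂ A z - a) * resolvent a z = 1 :=
  Ring.mul_inverse_cancel _ hz

variable [CompleteSpace A]

theorem summable_pow_mul_of_subgeometricDecay {c : ℕ → A}
    (hc : SubgeometricDecay (fun n => ‖c n‖)) (R : A) :
    Summable (fun n => (-1 : ℂ) ^ n • (R ^ n * c n)) := by
  refine .of_norm_bounded ((hc.summable_mul_pow (fun _ => norm_nonneg _)
    (norm_nonneg R)).mul_left (max ‖(1 : A)‖ 1)) fun n => ?_
  rw [norm_smul, norm_pow, norm_neg, norm_one, one_pow, one_mul, ← mul_assoc]
  exact (norm_mul_le _ _).trans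
    (mul_le_mul_of_nonneg_right (norm_pow_le_norm_one_mul R n) (norm_nonneg _))

theorem resolvent_mul_tsum_mul_sub_eq_one {a b : A}
    (hab : SubgeometricDecay (fun n => ‖(Cop a b ^ n) 1‖)) {z : ℂ} (hz : z ∈ resolventSet ℂ a) :
    (resolvent a z * ∑' n, (-1 : ℂ) ^ n • (resolvent a z ^ n * (Cop a b ^ n) 1)) *
      (algebraMap ℂ A z - b) = 1 := by
  have hs := summable_pow_mul_of_subgeometricDecay hab (resolvent a z)
  refine HasSum.unique ((hs.hasSum.mul_left (resolvent a z)).mul_right _) ?_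
  convert! hs.hasSum_sub_succ using 1
  · ext n
    have hcomm : (Cop a b ^ n) 1 * (algebraMap ℂ A z - b) =
        (algebraMap ℂ A z - a) * (Cop a b ^ n) 1 + (Cop a b ^ (n + 1)) 1 := by
      rw [Cop_pow_succ_one, mul_sub, sub_mul, Algebra.commutes z ((Cop a b ^ n) 1)]
      abel
    rw [mul_smul_comm, smul_mul_assoc, ← mul_assoc, ← pow_succ', mul_assoc, hcomm, mul_add,
      ← mul_assoc, pow_succ (resolvent a z), mul_assoc (_ ^ n), resolvent_mul_sub hz, mul_one,
      pow_succ (-1 : ℂ), mul_neg_one, neg_smul, smul_add, sub_neg_eq_add]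
  · simp

theorem sub_mul_tsum_mul_resolvent_eq_one {a b : A}
    (hba : SubgeometricDecay (fun n => ‖(Cop b a ^ n) 1‖)) {z : ℂ} (hz : z ∈ resolventSet ℂ a) :
    (algebraMap ℂ A z - b) * ((∑' n, (Cop b a ^ n) 1 * resolvent a z ^ n) * resolvent a z) = 1 := by
  have hs := summable_mul_pow_of_subgeometricDecay hba (resolvent a z)
  refine HasSum.unique ((hs.hasSum.mul_right (resolvent a z)).mul_left _) ?_
  convert! hs.hasSum_sub_succ using 1
  · ext n
    have hcomm : (algebraMap ℂ A z - b) * (Cop b a ^ n) 1 =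
        (Cop b a ^ n) 1 * (algebraMap ℂ A z - a) - (Cop b a ^ (n + 1)) 1 := by
      rw [Cop_pow_succ_one, mul_sub, sub_mul, Algebra.commutes z ((Cop b a ^ n) 1)]
      abel
    rw [mul_assoc, ← pow_succ, ← mul_assoc, hcomm, sub_mul, pow_succ', mul_assoc,
      ← mul_assoc (_ - a), sub_mul_resolvent hz, one_mul]
  · simp

theorem resolventSet_subset_of_subgeometricDecay {a b : A}
    (hab : SubgeometricDecay (fun n => ‖(Cop a b ^ n) 1‖))
    (hba : SubgeometricDecay (fun n => ‖(Cop b a ^ n) 1‖)) :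
    resolventSet ℂ a ⊆ resolventSet ℂ b := fun _ hz =>
  isUnit_iff_exists_and_exists.2 ⟨⟨_, sub_mul_tsum_mul_resolvent_eq_one hba hz⟩,
    ⟨_, resolvent_mul_tsum_mul_sub_eq_one hab hz⟩⟩

theorem spectrum_eq_of_subgeometricDecay {a b : A}
    (hab : SubgeometricDecay (fun n => ‖(Cop a b ^ n) 1‖))
    (hba : SubgeometricDecay (fun n => ‖(Cop b a ^ n) 1‖)) :
    spectrum ℂ a = spectrum ℂ b :=
  congrArg compl ((resolventSet_subset_of_subgeometricDecay hab hba).antisymm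
    (resolventSet_subset_of_subgeometricDecay hba hab))

theorem hasSum_resolvent {a b : A} (hab : SubgeometricDecay (fun n => ‖(Cop a b ^ n) 1‖))
    {z : ℂ} (ha : z ∈ resolventSet ℂ a) (hb : z ∈ resolventSet ℂ b) :
    HasSum (fun n => (-1 : ℂ) ^ n • (resolvent a z ^ (n + 1) * (Cop a b ^ n) 1))
      (resolvent b z) := by
  have h := ((summable_pow_mul_of_subgeometricDecay hab (resolvent a z)).hasSum.mul_left
    (resolvent a z))
  rw [left_inv_eq_right_inv (resolvent_mul_tsum_mul_sub_eq_one hab ha) (sub_mul_resolvent hb)] at h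
  simpa only [mul_smul_comm, ← mul_assoc, ← pow_succ'] using h

theorem hasDerivAt_resolvent_pow {a : A} {z : ℂ} (hz : z ∈ resolventSet ℂ a) (n : ℕ) :
    HasDerivAt (fun w => resolvent a w ^ n) (-(n : ℂ) • resolvent a z ^ (n + 1)) z := by
  induction n with
  | zero => simpa using hasDerivAt_const z (1 : A)
  | succ n ih =>
    simp only [pow_succ (resolvent a _) n]
    convert! ih.mul (spectrum.hasDerivAt_resolvent_const_left hz) using 1
    simp only [smul_mul_assoc, mul_neg, ← pow_succ, ← pow_add]
    push_cast
    module

theorem circleIntegral_resolvent_pow_mul_eq_zero {a : A} {c : ℂ} {r : ℝ} (hr : 0 ≤ r)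
    (ha : sphere c r ⊆ resolventSet ℂ a) {n : ℕ} (hn : n ≠ 0) (x : A) (s : ℂ) :
    (∮ z in C(c, r), s • (resolvent a z ^ (n + 1) * x)) = 0 := by
  refine circleIntegral.integral_eq_zero_of_hasDerivWithinAt hr
    (f := fun z => (s * (-(n : ℂ))⁻¹) • (resolvent a z ^ n * x)) fun z hz => ?_
  convert! (((hasDerivAt_resolvent_pow (ha hz) n).mul_const x).const_smul
    (s * (-(n : ℂ))⁻¹)).hasDerivWithinAt using 1
  have : (n : ℂ) ≠ 0 := by exact_mod_cast hn
  rw [smul_mul_assoc, smul_smul]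
  congr 1
  field_simp

theorem continuousOn_resolvent (a : A) : ContinuousOn (resolvent a) (resolventSet ℂ a) :=
  fun _ hz => (spectrum.hasDerivAt_resolvent_const_left hz).continuousAt.continuousWithinAt

theorem hasSum_circleIntegral_of_summable_norm {E : Type*} [NormedAddCommGroup E]
    [NormedSpace ℂ E] {f : ℕ → ℂ → E} {F : ℂ → E} {u : ℕ → ℝ} {c : ℂ} {r : ℝ} (hr : 0 ≤ r)
    (hf : ∀ n, ContinuousOn (f n) (sphere c r)) (hu : Summable u)
    (hfu : ∀ n, ∀ z ∈ sphere c r, ‖f n z‖ ≤ u n)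
    (hF : ∀ z ∈ sphere c r, HasSum (fun n => f n z) (F z)) :
    HasSum (fun n => ∮ z in C(c, r), f n z) (∮ z in C(c, r), F z) := by
  have hmem := circleMap_mem_sphere c hr
  refine intervalIntegral.hasSum_integral_of_dominated_convergence
    (fun n _ => r * u n) (fun n => ?_) (fun n => ?_) ?_ ?_ ?_
  · have hc : Continuous fun θ => f n (circleMap c r θ) :=
      (hf n).comp_continuous (continuous_circleMap c r) hmem
    simp only [deriv_circleMap]
    exact (((continuous_circleMap 0 r).mul continuous_const).smul hc).aestronglyMeasurable
  · refine .of_forall fun θ _ => ?_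
    rw [norm_smul, deriv_circleMap, norm_mul, norm_circleMap_zero, Complex.norm_I, mul_one,
      abs_of_nonneg hr]
    exact mul_le_mul_of_nonneg_left (hfu n _ (hmem θ)) hr
  · exact .of_forall fun _ _ => hu.mul_left r
  · exact intervalIntegrable_const
  · exact .of_forall fun θ _ => (hF _ (hmem θ)).const_smul _

theorem rieszP_eq_of_subgeometricDecay {a b : A}
    (hab : SubgeometricDecay (fun n => ‖(Cop a b ^ n) 1‖)) {c : ℂ} {r : ℝ} (hr : 0 ≤ r)
    (ha : sphere c r ⊆ resolventSet ℂ a) (hb : sphere c r ⊆ resolventSet ℂ b) :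
    rieszP a c r = rieszP b c r := by
  have hcont := (continuousOn_resolvent a).mono ha
  obtain ⟨M, hM⟩ := (isCompact_sphere c r).exists_bound_of_continuousOn hcont
  have hM' : ∀ z ∈ sphere c r, ‖resolvent a z‖ ≤ max M 0 := fun z hz =>
    (hM z hz).trans (le_max_left _ _)
  have hsum := hasSum_circleIntegral_of_summable_norm hr
    (f := fun n z => (-1 : ℂ) ^ n • (resolvent a z ^ (n + 1) * (Cop a b ^ n) 1))
    (fun n => ((hcont.pow (n + 1)).mul continuousOn_const).const_smul _)
    ((hab.summable_mul_pow (fun _ => norm_nonneg _) (le_max_right M 0)).mul_left (max M 0))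
    (fun n z hz => by
      rw [norm_smul, norm_pow, norm_neg, norm_one, one_pow, one_mul, ← mul_assoc, ← pow_succ']
      refine (norm_mul_le _ _).trans (mul_le_mul_of_nonneg_right ?_ (norm_nonneg _))
      exact (norm_pow_le' _ n.succ_pos).trans (pow_le_pow_left₀ (norm_nonneg _) (hM' z hz) _))
    (fun z hz => hasSum_resolvent hab (ha hz) (hb hz))
  have hzero := hsum.unique (hasSum_single 0 fun n hn =>
    circleIntegral_resolvent_pow_mul_eq_zero hr ha hn _ _)
  simp only [pow_zero, zero_add, pow_one, one_smul, Module.End.one_apply, mul_one] at hzero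
  exact congrArg _ hzero.symm

end NormedAlgebra

section Riesz

theorem sphere_subset_resolventSet_of_inter_closedBall [NormedRing A] [NormedAlgebra ℂ A] {a : A}
    {c : ℂ} {r : ℝ} (hr : 0 < r) (h : spectrum ℂ a ∩ closedBall c r = {c}) :
    sphere c r ⊆ resolventSet ℂ a := by
  intro z hz
  by_contra hza
  have hmem : z ∈ spectrum ℂ a ∩ closedBall c r := ⟨hza, sphere_subset_closedBall hz⟩
  rw [h, Set.mem_singleton_iff] at hmem
  rw [hmem, mem_sphere, dist_self] at hz
  exact hr.ne hz

theorem exists_inter_closedBall_eq_singleton {S : Set ℂ} (hS : S.Finite) {c : ℂ} (hc : c ∈ S) :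
    ∃ r : ℝ, 0 < r ∧ S ∩ closedBall c r = {c} := by
  have hnhds : (S \ {c})ᶜ ∈ nhds c :=
    (hS.subset Set.sdiff_subset).isClosed.isOpen_compl.mem_nhds (by simp)
  obtain ⟨r, hr, hsub⟩ := nhds_basis_closedBall.mem_iff.1 hnhds
  refine ⟨r, hr, Set.Subset.antisymm (fun z hz => ?_) ?_⟩
  · by_contra hzc
    exact hsub hz.2 ⟨hz.1, hzc⟩
  · rintro _ rfl
    exact ⟨hc, mem_closedBall_self hr.le⟩

theorem rieszIdem_eq_of_subgeometricDecay [NormedRing A] [NormedAlgebra ℂ A] [CompleteSpace A]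
    {a b : A} (hab : SubgeometricDecay (fun n => ‖(Cop a b ^ n) 1‖))
    (hσ : spectrum ℂ a = spectrum ℂ b) (lam : ℂ) :
    rieszIdem a lam = rieszIdem b lam := by
  unfold rieszIdem
  rw [← hσ]
  split_ifs with h
  · have hs := h.choose_spec
    exact rieszP_eq_of_subgeometricDecay hab hs.1.le
      (sphere_subset_resolventSet_of_inter_closedBall hs.1 hs.2)
      (sphere_subset_resolventSet_of_inter_closedBall hs.1 (hσ ▸ hs.2))
  · rfl

theorem map_ringInverse_of_isUnit {M N F : Type*} [MonoidWithZero M] [MonoidWithZero N]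
    [FunLike F M N] [MonoidHomClass F M N] (φ : F) {x : M} (hx : IsUnit x) :
    φ (Ring.inverse x) = Ring.inverse (φ x) := by
  obtain ⟨u, rfl⟩ := hx
  rw [Ring.inverse_unit]
  exact (Ring.inverse_unit (Units.map (φ : M →* N) u)).symm

theorem map_rieszP {B C : Type*} [NormedRing B] [NormedAlgebra ℂ B] [CompleteSpace B]
    [NormedRing C] [NormedAlgebra ℂ C] [CompleteSpace C] (φ : B →ₐ[ℂ] C) (hφ : Continuous φ)
    {x : B} {c : ℂ} {r : ℝ} (hr : 0 ≤ r) (hx : sphere c r ⊆ resolventSet ℂ x) :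
    φ (rieszP x c r) = rieszP (φ x) c r := by
  let L : B →L[ℂ] C := ⟨φ.toLinearMap, hφ⟩
  have hL : ∀ y, φ y = L y := fun _ => rfl
  have hcont : Continuous fun θ => resolvent x (circleMap c r θ) :=
    ((continuousOn_resolvent x).mono hx).comp_continuous (continuous_circleMap c r)
      (circleMap_mem_sphere c hr)
  have hint : IntervalIntegrable
      (fun θ => deriv (circleMap c r) θ • resolvent x (circleMap c r θ))
      MeasureTheory.volume 0 (2 * Real.pi) := by
    simp only [deriv_circleMap]
    exact (((continuous_circleMap 0 r).mul continuous_const).smul hcont).intervalIntegrable _ _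
  unfold rieszP
  rw [map_smul]
  congr 1
  refine (L.intervalIntegral_comp_comm hint).symm.trans
    (intervalIntegral.integral_congr fun θ _ => ?_)
  simp only [map_smul]
  congr 1
  have hz := hx (circleMap_mem_sphere c hr θ)
  have hmap : algebraMap ℂ C (circleMap c r θ) - φ x = φ (algebraMap ℂ B (circleMap c r θ) - x) := by
    rw [map_sub, AlgHomClass.commutes]
  rw [hmap]
  exact map_ringInverse_of_isUnit φ hz

theorem rieszP_complex_of_mem_ball {w c : ℂ} {r : ℝ} (hw : w ∈ ball c r) : rieszP w c r = 1 := by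
  simp only [rieszP, Algebra.algebraMap_self, RingHom.id_apply, Ring.inverse_eq_inv',
    circleIntegral.integral_sub_inv_of_mem_ball hw, smul_eq_mul]
  exact inv_mul_cancel₀ Complex.two_pi_I_ne_zero

theorem rieszP_complex_of_notMem_closedBall {w c : ℂ} {r : ℝ} (hr : 0 ≤ r)
    (hw : w ∉ closedBall c r) : rieszP w c r = 0 := by
  have hne : ∀ z ∈ closedBall c r, z - w ≠ 0 := fun z hz h => hw (sub_eq_zero.1 h ▸ hz)
  have : (∮ z in C(c, r), (z - w)⁻¹) = 0 :=
    Complex.circleIntegral_eq_zero_of_differentiable_on_off_countable hr Set.countable_empty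
      (ContinuousOn.inv₀ (by fun_prop) hne)
      fun z hz => DifferentiableAt.inv (by fun_prop) (hne z (ball_subset_closedBall hz.1))
  simp only [rieszP, Algebra.algebraMap_self, RingHom.id_apply, Ring.inverse_eq_inv', this,
    smul_zero]

open scoped Classical in
theorem algHom_rieszIdem {B : Type*} [NormedRing B] [NormedAlgebra ℂ B] [CompleteSpace B]
    (φ : B →ₐ[ℂ] ℂ) {x : B} (hfin : (spectrum ℂ x).Finite) {lam : ℂ} (hlam : lam ∈ spectrum ℂ x) :
    φ (rieszIdem x lam) = if φ x = lam then 1 else 0 := by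
  have h := exists_inter_closedBall_eq_singleton hfin hlam
  rw [rieszIdem, dif_pos h]
  obtain ⟨hr, hs⟩ := h.choose_spec
  rw [map_rieszP φ (map_continuous φ) hr.le
    (sphere_subset_resolventSet_of_inter_closedBall hr hs)]
  split_ifs with hφ
  · exact rieszP_complex_of_mem_ball (by rw [hφ]; exact mem_ball_self hr)
  · refine rieszP_complex_of_notMem_closedBall hr.le fun hmem => hφ ?_
    have hmem' : φ x ∈ spectrum ℂ x ∩ closedBall lam h.choose :=
      ⟨AlgHom.apply_mem_spectrum φ x, hmem⟩
    rwa [hs] at hmem'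

theorem spectralRadius_sub_finsum_rieszIdem {B : Type*} [NormedRing B] [NormedAlgebra ℂ B]
    [CompleteSpace B] (hcomm : ∀ x y : B, x * y = y * x) {x : B}
    (hfin : (spectrum ℂ x).Finite) :
    spectralRadius ℂ (x - ∑ᶠ lam ∈ spectrum ℂ x, lam • rieszIdem x lam) = 0 := by
  classical
  let _ : NormedCommRing B := { ‹NormedRing B› with mul_comm := hcomm }
  simp only [spectralRadius, ENNReal.iSup_eq_zero]
  intro z hz
  obtain ⟨f, hf⟩ := WeakDual.CharacterSpace.mem_spectrum_iff_exists.1 hz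
  let φ : B →ₐ[ℂ] ℂ := WeakDual.CharacterSpace.toAlgHom f
  have hz0 : φ (x - ∑ᶠ lam ∈ spectrum ℂ x, lam • rieszIdem x lam) = 0 := by
    rw [finsum_mem_eq_finite_toFinset_sum _ hfin, map_sub, map_sum,
      Finset.sum_congr rfl fun lam hlam => by
        rw [map_smul, algHom_rieszIdem φ hfin (hfin.mem_toFinset.1 hlam)]]
    simp [AlgHom.apply_mem_spectrum φ x]
  have : z = 0 := hf.symm.trans hz0
  simp [this]

theorem subgeometricDecay_norm_pow_of_spectralRadius_eq_zero {B : Type*} [NormedRing B]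
    [NormedAlgebra ℂ B] [CompleteSpace B] {x : B} (hx : spectralRadius ℂ x = 0) :
    SubgeometricDecay (fun n => ‖x ^ n‖) := by
  intro ε hε
  have h := spectrum.pow_norm_pow_one_div_tendsto_nhds_spectralRadius x
  rw [hx] at h
  refine exists_le_mul_pow_of_eventually_rpow_lt (fun _ => norm_nonneg _) hε ?_
  filter_upwards [h.eventually_lt_const (ENNReal.ofReal_pos.2 hε)] with n hn
  exact (ENNReal.ofReal_lt_ofReal_iff hε).1 hn

theorem map_rieszIdem_of_spectrum_eq {B C : Type*} [NormedRing B] [NormedAlgebra ℂ B]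
    [CompleteSpace B] [NormedRing C] [NormedAlgebra ℂ C] [CompleteSpace C] (φ : B →ₐ[ℂ] C)
    (hφ : Continuous φ) {x : B} (hσ : spectrum ℂ x = spectrum ℂ (φ x)) (lam : ℂ) :
    φ (rieszIdem x lam) = rieszIdem (φ x) lam := by
  unfold rieszIdem
  rw [← hσ]
  split_ifs with h
  · exact map_rieszP φ hφ h.choose_spec.1.le
      (sphere_subset_resolventSet_of_inter_closedBall h.choose_spec.1 h.choose_spec.2)
  · exact map_zero φ

variable [NormedRing A] [NormedAlgebra ℂ A] [CompleteSpace A]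

theorem spectrum_elemental_eq {a : A} (hfin : (spectrum ℂ a).Finite) :
    spectrum ℂ (⟨a, Algebra.elemental.self_mem ℂ a⟩ : Algebra.elemental ℂ a) = spectrum ℂ a := by
  refine Subalgebra.spectrum_eq_of_isPreconnected_compl (Algebra.elemental ℂ a) _ ?_
  exact (hfin.countable.isConnected_compl_of_one_lt_rank
    (by rw [Complex.rank_real_complex]; exact Cardinal.one_lt_two)).isPreconnected

theorem commute_and_subgeometricDecay_of_isometry {B : Type*} [NormedRing B] [NormedAlgebra ℂ B]
    [CompleteSpace B] (hcomm : ∀ y z : B, y * z = z * y) (φ : B →ₐ[ℂ] A) (hφ : Isometry φ)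
    {x : B} (hσ : spectrum ℂ x = spectrum ℂ (φ x)) (hfin : (spectrum ℂ x).Finite) :
    Commute (∑ᶠ lam ∈ spectrum ℂ (φ x), lam • rieszIdem (φ x) lam) (φ x) ∧
      SubgeometricDecay
        (fun n => ‖(φ x - ∑ᶠ lam ∈ spectrum ℂ (φ x), lam • rieszIdem (φ x) lam) ^ n‖) := by
  have hsum : φ (∑ᶠ lam ∈ spectrum ℂ x, lam • rieszIdem x lam) =
      ∑ᶠ lam ∈ spectrum ℂ (φ x), lam • rieszIdem (φ x) lam := by
    rw [← hσ, finsum_mem_eq_finite_toFinset_sum _ hfin, finsum_mem_eq_finite_toFinset_sum _ hfin,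
      map_sum]
    simp only [map_smul, map_rieszIdem_of_spectrum_eq φ hφ.continuous hσ]
  have hnorm : ∀ y, ‖φ y‖ = ‖y‖ := (AddMonoidHomClass.isometry_iff_norm φ).1 hφ
  rw [← hsum]
  simp only [← map_sub, ← map_pow, hnorm]
  exact ⟨Commute.map (hcomm _ x) φ, subgeometricDecay_norm_pow_of_spectralRadius_eq_zero
    (spectralRadius_sub_finsum_rieszIdem hcomm hfin)⟩

theorem commute_and_subgeometricDecay_finsum_rieszIdem {a : A} (hfin : (spectrum ℂ a).Finite) :
    Commute (∑ᶠ lam ∈ spectrum ℂ a, lam • rieszIdem a lam) a ∧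
      SubgeometricDecay
        (fun n => ‖(a - ∑ᶠ lam ∈ spectrum ℂ a, lam • rieszIdem a lam) ^ n‖) :=
  have hσ := spectrum_elemental_eq hfin
  commute_and_subgeometricDecay_of_isometry (fun y z : Algebra.elemental ℂ a => mul_comm y z)
    (Algebra.elemental ℂ a).val isometry_subtype_coe
    (x := ⟨a, Algebra.elemental.self_mem ℂ a⟩) hσ (hσ ▸ hfin)

end Riesz

theorem stmt15 [NormedRing A] [NormedAlgebra ℂ A] [CompleteSpace A]
    (a b : A) (hfin : (spectrum ℂ a).Finite) :
    qd a b = 0 ↔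
      spectrum ℂ a = spectrum ℂ b ∧
        ∀ lam ∈ spectrum ℂ a, rieszIdem a lam = rieszIdem b lam := by
  rw [qd_eq_zero_iff]
  constructor
  · rw [rho_eq_zero_iff, rho_eq_zero_iff]
    rintro ⟨hab, hba⟩
    have hσ := spectrum_eq_of_subgeometricDecay hab hba
    exact ⟨hσ, fun lam _ => rieszIdem_eq_of_subgeometricDecay hab hσ lam⟩
  · rintro ⟨hσ, hp⟩
    obtain ⟨hca, hda⟩ := commute_and_subgeometricDecay_finsum_rieszIdem hfin
    obtain ⟨hcb, hdb⟩ := commute_and_subgeometricDecay_finsum_rieszIdem (hσ ▸ hfin)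
    have hsum : ∑ᶠ lam ∈ spectrum ℂ b, lam • rieszIdem b lam =
        ∑ᶠ lam ∈ spectrum ℂ a, lam • rieszIdem a lam :=
      finsum_mem_congr hσ.symm fun lam hlam => by rw [hp lam (hσ ▸ hlam)]
    rw [hsum] at hcb hdb
    exact ⟨rho_eq_zero_of_commute hca hcb hda hdb, rho_eq_zero_of_commute hcb hca hdb hda⟩
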